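/- arXiv:math/0501182 — 2 statements merged into one kernel-verified Lean document; each statement's English description precedes it below -/
import Mathlib

section
/- Let α ∈ (1,2) and let μ be a Borel probability measure on ℝ whose characteristic function satisfies ∫ℝ e^{iλx} μ(dx) = exp(−|λ|^α) for all λ ∈ ℝ. Then for every γ with −1 < γ < α, ∫ℝ |x|^γ μ(dx) = 2^γ·Γ((1+γ)/2)·Γ((α−γ)/α)/(√π·Γ((2−γ)/2)), where Γ is the Gamma function. -/
open MeasureTheory ProbabilityTheory Set Filter Topology

/-- The Laplace kernel used to represent `|x| ^ γ` as a Mellin transform: `exp (-y)` for `γ < 0`,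
and its complement `1 - exp (-y)` for `γ ≥ 0`. -/
noncomputable def mellinKernel (γ y : ℝ) : ℝ :=
  if γ < 0 then Real.exp (-y) else 1 - Real.exp (-y)

lemma measurable_mellinKernel (γ : ℝ) : Measurable (mellinKernel γ) := by
  unfold mellinKernel
  split_ifs <;> fun_prop

lemma mellinKernel_nonneg (γ : ℝ) {y : ℝ} (hy : 0 ≤ y) : 0 ≤ mellinKernel γ y := by
  unfold mellinKernel
  split_ifs
  · positivity
  · simpa using hy

lemma lintegral_rpow_mul_exp_neg_mul_rpow {p q c : ℝ} (hp : 0 < p) (hq : -1 < q) (hc : 0 < c) :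
    ∫⁻ s in Ioi (0 : ℝ), ENNReal.ofReal (s ^ q * Real.exp (-(c * s ^ p))) =
      ENNReal.ofReal (c ^ (-(q + 1) / p) * (1 / p) * Real.Gamma ((q + 1) / p)) := by
  rw [← integral_rpow_mul_exp_neg_mul_rpow hp hq hc, ofReal_integral_eq_lintegral_ofReal]
  · simp only [neg_mul]
  · exact integrableOn_rpow_mul_exp_neg_mul_rpow hq hp hc
  · filter_upwards [self_mem_ae_restrict measurableSet_Ioi] with s hs
    have : 0 < s := hs
    simp only [Pi.zero_apply]
    positivity

lemma ofReal_mul_one_sub_exp_neg_mul_rpow {b c s k : ℝ} (hb : 1 ≤ b) (hc : 0 < c) (hs : 0 < s)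
    (hk : 0 ≤ k) :
    ENNReal.ofReal (k * (1 - Real.exp (-(c * s ^ b)))) =
      ∫⁻ r in Ioo 0 s,
        ENNReal.ofReal (k * (c * b * (r ^ (b - 1) * Real.exp (-(c * r ^ b))))) := by
  have hb0 : 0 < b := by linarith
  have hcont : Continuous fun r : ℝ ↦ c * b * (r ^ (b - 1) * Real.exp (-(c * r ^ b))) := by
    have h1 := Real.continuous_rpow_const hb0.le
    have h2 := Real.continuous_rpow_const (q := b - 1) (by linarith)
    fun_prop
  have hFTC : ∫ r in (0 : ℝ)..s, c * b * (r ^ (b - 1) * Real.exp (-(c * r ^ b))) =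
      1 - Real.exp (-(c * s ^ b)) := by
    rw [intervalIntegral.integral_eq_sub_of_hasDerivAt (f := fun r ↦ - Real.exp (-(c * r ^ b)))]
    · simp [Real.zero_rpow hb0.ne']
      ring
    · intro r _
      have h := (((Real.hasDerivAt_rpow_const (x := r) (p := b) (Or.inr hb)).const_mul
        c).neg.exp).neg
      refine h.congr_deriv ?_
      simp only [Pi.neg_apply]
      ring
    · exact hcont.intervalIntegrable _ _
  rw [← hFTC, intervalIntegral.integral_of_le hs.le, integral_Ioc_eq_integral_Ioo,
    ← integral_const_mul, ofReal_integral_eq_lintegral_ofReal]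
  · exact ((hcont.const_mul k).integrableOn_Icc (a := 0) (b := s)).mono_set Ioo_subset_Icc_self
  · filter_upwards [self_mem_ae_restrict measurableSet_Ioo] with r hr
    have : 0 < r := hr.1
    simp only [Pi.zero_apply]
    positivity

lemma lintegral_rpow_mul_one_sub_exp_neg_mul_rpow {γ b c : ℝ} (hγ : 0 < γ) (hb : 1 ≤ b)
    (hγb : γ < b) (hc : 0 < c) :
    ∫⁻ s in Ioi (0 : ℝ), ENNReal.ofReal (s ^ (-γ - 1) * (1 - Real.exp (-(c * s ^ b)))) =
      ENNReal.ofReal (c ^ (γ / b) * Real.Gamma (1 - γ / b) / γ) := by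
  have hb0 : 0 < b := by linarith
  set h : ℝ → ℝ := fun r ↦ c * b * (r ^ (b - 1) * Real.exp (-(c * r ^ b))) with hh
  have hh_meas : Measurable h := by fun_prop
  set F : ℝ → ℝ → ENNReal := fun s r ↦
    if r < s then ENNReal.ofReal (s ^ (-γ - 1) * h r) else 0 with hF
  have hF_meas : Measurable (Function.uncurry F) :=
    Measurable.ite (measurableSet_lt measurable_snd measurable_fst) (by fun_prop) measurable_const
  have hleft : ∀ s ∈ Ioi (0 : ℝ),
      ENNReal.ofReal (s ^ (-γ - 1) * (1 - Real.exp (-(c * s ^ b)))) = ∫⁻ r in Ioi 0, F s r := by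
    intro s hs
    have hs0 : 0 < s := hs
    have : F s = (Iio s).indicator fun r ↦ ENNReal.ofReal (s ^ (-γ - 1) * h r) := by
      ext r; simp [hF, indicator]
    rw [ofReal_mul_one_sub_exp_neg_mul_rpow hb hc hs0 (by positivity), this,
      lintegral_indicator measurableSet_Iio, Measure.restrict_restrict measurableSet_Iio,
      inter_comm, Ioi_inter_Iio]
  have hright : ∀ r ∈ Ioi (0 : ℝ), ∫⁻ s in Ioi 0, F s r =
      ENNReal.ofReal (c * b / γ) *
        ENNReal.ofReal (r ^ (b - 1 - γ) * Real.exp (-(c * r ^ b))) := by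
    intro r hr
    have hr0 : 0 < r := hr
    have hhr : 0 ≤ h r := by simp only [hh]; positivity
    have : (fun s ↦ F s r) = (Ioi r).indicator fun s ↦ ENNReal.ofReal (s ^ (-γ - 1) * h r) := by
      ext s; simp [hF, indicator]
    rw [this, lintegral_indicator measurableSet_Ioi, Measure.restrict_restrict measurableSet_Ioi,
      inter_eq_left.2 (Ioi_subset_Ioi hr0.le), ← ofReal_integral_eq_lintegral_ofReal,
      integral_mul_const, integral_Ioi_rpow_of_lt (by linarith) hr0,
      ← ENNReal.ofReal_mul (by positivity)]
    · congr 1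
      have h1 : r ^ (b - 1 - γ) = r ^ (-γ - 1 + 1) * r ^ (b - 1) := by
        rw [← Real.rpow_add hr0]; congr 1; ring
      rw [h1, hh, show -γ - 1 + 1 = -γ by ring]
      field_simp
    · exact (integrableOn_Ioi_rpow_of_lt (by linarith) hr0).mul_const _
    · filter_upwards [self_mem_ae_restrict measurableSet_Ioi] with s hs
      have : 0 < s := hr0.trans hs
      simp only [Pi.zero_apply]
      positivity
  rw [setLIntegral_congr_fun measurableSet_Ioi hleft,
    lintegral_lintegral_swap hF_meas.aemeasurable, setLIntegral_congr_fun measurableSet_Ioi hright,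
    lintegral_const_mul' _ _ ENNReal.ofReal_ne_top,
    lintegral_rpow_mul_exp_neg_mul_rpow hb0 (by linarith) hc, ← ENNReal.ofReal_mul (by positivity)]
  congr 1
  have h1 : -(b - 1 - γ + 1) / b = γ / b - 1 := by field_simp; ring
  have h2 : (b - 1 - γ + 1) / b = 1 - γ / b := by field_simp; ring
  rw [h1, h2, Real.rpow_sub_one hc.ne']
  field_simp

lemma lintegral_rpow_mul_mellinKernel {γ b c : ℝ} (hγ : γ ≠ 0) (hb : 1 ≤ b) (hγb : γ < b)
    (hc : 0 < c) :
    ∫⁻ s in Ioi (0 : ℝ), ENNReal.ofReal (s ^ (-γ - 1) * mellinKernel γ (c * s ^ b)) =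
      ENNReal.ofReal (c ^ (γ / b) * Real.Gamma (1 - γ / b) / |γ|) := by
  have hb0 : 0 < b := by linarith
  rcases hγ.lt_or_gt with hneg | hpos
  · simp only [mellinKernel, if_pos hneg]
    rw [lintegral_rpow_mul_exp_neg_mul_rpow hb0 (by linarith) hc]
    congr 1
    have hne : -(γ / b) ≠ 0 := by simp [hγ, hb0.ne']
    rw [show 1 - γ / b = -(γ / b) + 1 by ring, Real.Gamma_add_one hne, abs_of_neg hneg,
      show -(-γ - 1 + 1) / b = γ / b by ring, show (-γ - 1 + 1) / b = -(γ / b) by ring]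
    field_simp
  · simp only [mellinKernel, if_neg hpos.not_gt]
    rw [lintegral_rpow_mul_one_sub_exp_neg_mul_rpow hpos hb hγb hc, abs_of_pos hpos]

/-- Integrating the Mellin representation of `|x| ^ γ` against a measure. -/
lemma lintegral_Ioi_lintegral_mellinKernel {μ : Measure ℝ} [IsProbabilityMeasure μ]
    {γ b c : ℝ} (hγ : γ ≠ 0) (hb : 1 ≤ b) (hγb : γ < b) (hc : 0 < c) (hμ : μ {0} = 0) :
    ∫⁻ s in Ioi (0 : ℝ), ENNReal.ofReal (s ^ (-γ - 1)) *
        ENNReal.ofReal (∫ x, mellinKernel γ (c * |x| ^ b * s ^ b) ∂μ) =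
      ENNReal.ofReal (c ^ (γ / b) * Real.Gamma (1 - γ / b) / |γ|) *
        ∫⁻ x, ENNReal.ofReal (|x| ^ γ) ∂μ := by
  have hb0 : 0 < b := by linarith
  have hmeas := measurable_mellinKernel γ
  have hΓ : 0 < Real.Gamma (1 - γ / b) :=
    Real.Gamma_pos_of_pos (by rw [sub_pos, div_lt_one hb0]; exact hγb)
  have hin : ∀ s ∈ Ioi (0 : ℝ), ENNReal.ofReal (s ^ (-γ - 1)) *
        ENNReal.ofReal (∫ x, mellinKernel γ (c * |x| ^ b * s ^ b) ∂μ) =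
      ∫⁻ x, ENNReal.ofReal (s ^ (-γ - 1) * mellinKernel γ (c * |x| ^ b * s ^ b)) ∂μ := by
    intro s hs
    have hs0 : 0 < s := hs
    have hy : ∀ x : ℝ, 0 ≤ c * |x| ^ b * s ^ b := fun x ↦ by positivity
    rw [ofReal_integral_eq_lintegral_ofReal, ← lintegral_const_mul' _ _ ENNReal.ofReal_ne_top]
    · refine lintegral_congr fun x ↦ ?_
      rw [ENNReal.ofReal_mul (by positivity)]
    · refine Integrable.of_bound (C := 1) (Measurable.aestronglyMeasurable (by fun_prop))
        (ae_of_all _ fun x ↦ ?_)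
      rw [Real.norm_of_nonneg (mellinKernel_nonneg γ (hy x))]
      unfold mellinKernel
      split_ifs
      · simpa using hy x
      · simpa using Real.exp_nonneg _
    · exact ae_of_all _ fun x ↦ mellinKernel_nonneg γ (hy x)
  rw [setLIntegral_congr_fun measurableSet_Ioi hin, lintegral_lintegral_swap (by fun_prop),
    ← lintegral_const_mul' _ _ ENNReal.ofReal_ne_top]
  refine lintegral_congr_ae ?_
  have hae : ∀ᵐ x ∂μ, x ≠ 0 := by
    rw [ae_iff]; simpa using hμ
  filter_upwards [hae] with x hx
  have hx' : 0 < |x| := abs_pos.2 hx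
  rw [lintegral_rpow_mul_mellinKernel hγ hb hγb (by positivity),
    ← ENNReal.ofReal_mul (by positivity)]
  congr 1
  rw [Real.mul_rpow hc.le (by positivity), ← Real.rpow_mul hx'.le, mul_div_cancel₀ _ hb0.ne']
  ring

lemma integral_abs_rpow_gaussianReal {γ : ℝ} (hγ : -1 < γ) :
    ∫ x, |x| ^ γ ∂(gaussianReal 0 1) =
      2 ^ (γ / 2) * Real.Gamma ((1 + γ) / 2) / Real.sqrt Real.pi := by
  rw [integral_gaussianReal_eq_integral_smul one_ne_zero]
  have h : ∀ x : ℝ, gaussianPDFReal 0 1 x • |x| ^ γ =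
      (Real.sqrt (2 * Real.pi))⁻¹ *
        (fun y : ℝ ↦ y ^ γ * Real.exp (-(1 / 2) * y ^ (2 : ℝ))) |x| := by
    intro x
    simp only [gaussianPDFReal, smul_eq_mul, NNReal.coe_one, mul_one, sub_zero, Real.rpow_two,
      sq_abs]
    rw [show -x ^ 2 / 2 = -(1 / 2) * x ^ 2 by ring]
    ring
  simp_rw [h]
  rw [integral_const_mul,
    integral_comp_abs (f := fun y : ℝ ↦ y ^ γ * Real.exp (-(1 / 2) * y ^ (2 : ℝ))),
    integral_rpow_mul_exp_neg_mul_rpow two_pos hγ (by norm_num)]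
  have h2 : (1 / 2 : ℝ) ^ (-(γ + 1) / 2) = 2 ^ (γ / 2) * Real.sqrt 2 := by
    rw [one_div, Real.inv_rpow two_pos.le, ← Real.rpow_neg two_pos.le, Real.sqrt_eq_rpow,
      ← Real.rpow_add two_pos]
    congr 1; ring
  rw [h2, Real.sqrt_mul two_pos.le, add_comm γ 1]
  have : Real.sqrt 2 ≠ 0 := by positivity
  have : Real.sqrt Real.pi ≠ 0 := by positivity
  field_simp

/-- Gaussian averaging of the characteristic function of a symmetric stable law. -/
lemma integral_exp_neg_eq_of_charFun_stable {α : ℝ} {μ : Measure ℝ} [IsProbabilityMeasure μ]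
    (hchar : ∀ lam : ℝ, charFun μ lam = (Real.exp (-(|lam| ^ α)) : ℝ)) {s : ℝ} (hs : 0 < s) :
    ∫ x, Real.exp (-(1 / 2 * |x| ^ (2 : ℝ) * s ^ (2 : ℝ))) ∂μ =
      ∫ u, Real.exp (-(1 * |u| ^ α * s ^ α)) ∂(gaussianReal 0 1) := by
  have hexp : Integrable (Function.uncurry fun x u : ℝ ↦
      Complex.exp (((s * u : ℝ) : ℂ) * x * Complex.I)) (μ.prod (gaussianReal 0 1)) := by
    refine Integrable.of_bound (C := 1) (by fun_prop) (ae_of_all _ fun p ↦ ?_)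
    simp only [Function.uncurry]
    rw [← Complex.ofReal_mul, Complex.norm_exp_ofReal_mul_I]
  have hswap := integral_integral_swap hexp
  have hl : ∀ x : ℝ, ∫ u, Complex.exp (((s * u : ℝ) : ℂ) * x * Complex.I) ∂(gaussianReal 0 1) =
      ((Real.exp (-(1 / 2 * |x| ^ (2 : ℝ) * s ^ (2 : ℝ))) : ℝ) : ℂ) := by
    intro x
    have h := charFun_gaussianReal (μ := 0) (v := 1) (s * x)
    rw [charFun_apply_real] at h
    simp only [Real.rpow_two, sq_abs]
    push_cast at h ⊢
    convert h using 2
    · ext u; congr 1; ring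
    · ring
  have hr : ∀ u : ℝ, ∫ x, Complex.exp (((s * u : ℝ) : ℂ) * x * Complex.I) ∂μ =
      ((Real.exp (-(1 * |u| ^ α * s ^ α)) : ℝ) : ℂ) := by
    intro u
    rw [← charFun_apply_real, hchar, abs_mul, abs_of_pos hs,
      Real.mul_rpow hs.le (abs_nonneg u), one_mul, mul_comm]
  simp_rw [hl, hr, integral_complex_ofReal] at hswap
  exact_mod_cast hswap

lemma integrable_exp_neg_mul_abs_rpow {ν : Measure ℝ} [IsFiniteMeasure ν] {b c s : ℝ}
    (hc : 0 ≤ c) (hs : 0 < s) :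
    Integrable (fun x : ℝ ↦ Real.exp (-(c * |x| ^ b * s ^ b))) ν := by
  refine Integrable.of_bound (C := 1) (Measurable.aestronglyMeasurable (by fun_prop))
    (ae_of_all _ fun x ↦ ?_)
  rw [Real.norm_of_nonneg (Real.exp_nonneg _), Real.exp_le_one_iff, neg_nonpos]
  positivity

lemma measure_singleton_zero_of_charFun_stable {α : ℝ} (hα : 0 < α) {μ : Measure ℝ}
    [IsProbabilityMeasure μ]
    (hchar : ∀ lam : ℝ, charFun μ lam = (Real.exp (-(|lam| ^ α)) : ℝ)) : μ {0} = 0 := by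
  have hatom : gaussianReal 0 1 {(0 : ℝ)} = 0 := by
    have := nullSingletonClass_gaussianReal (μ := 0) (v := 1) one_ne_zero
    exact measure_singleton 0
  have hlim : Tendsto (fun s : ℝ ↦ ∫ u, Real.exp (-(1 * |u| ^ α * s ^ α)) ∂(gaussianReal 0 1))
      atTop (𝓝 (∫ _, (0 : ℝ) ∂(gaussianReal 0 1))) := by
    refine tendsto_integral_filter_of_dominated_convergence (fun _ ↦ 1)
      (Eventually.of_forall fun s ↦ Measurable.aestronglyMeasurable (by fun_prop)) ?_ (integrable_const _) ?_
    · filter_upwards [eventually_gt_atTop 0] with s hs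
      refine ae_of_all _ fun u ↦ ?_
      rw [Real.norm_of_nonneg (Real.exp_nonneg _), Real.exp_le_one_iff, neg_nonpos]
      positivity
    · have hae : ∀ᵐ u ∂(gaussianReal 0 1), u ≠ 0 := by
        rw [ae_iff]; simpa using hatom
      filter_upwards [hae] with u hu
      have : 0 < |u| := abs_pos.2 hu
      exact Real.tendsto_exp_neg_atTop_nhds_zero.comp
        ((tendsto_rpow_atTop hα).const_mul_atTop (by positivity))
  have hle : μ.real {0} ≤ 0 := by
    rw [integral_zero] at hlim
    refine ge_of_tendsto hlim ?_
    filter_upwards [eventually_gt_atTop 0] with s hs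
    rw [← integral_exp_neg_eq_of_charFun_stable hchar hs,
      ← integral_indicator_one (measurableSet_singleton 0)]
    refine integral_mono ((integrable_const 1).indicator (measurableSet_singleton 0))
      (integrable_exp_neg_mul_abs_rpow (by norm_num) hs) fun x ↦ ?_
    by_cases hx : x = 0
    · simp [hx]
    · simpa [hx] using Real.exp_nonneg _
  exact (measureReal_eq_zero_iff).1 (le_antisymm hle measureReal_nonneg)

lemma integral_mellinKernel_eq_of_charFun_stable {α : ℝ} {μ : Measure ℝ}
    [IsProbabilityMeasure μ]
    (hchar : ∀ lam : ℝ, charFun μ lam = (Real.exp (-(|lam| ^ α)) : ℝ)) (γ : ℝ) {s : ℝ}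
    (hs : 0 < s) :
    ∫ x, mellinKernel γ (1 / 2 * |x| ^ (2 : ℝ) * s ^ (2 : ℝ)) ∂μ =
      ∫ u, mellinKernel γ (1 * |u| ^ α * s ^ α) ∂(gaussianReal 0 1) := by
  have h := integral_exp_neg_eq_of_charFun_stable hchar hs
  unfold mellinKernel
  split_ifs
  · exact h
  · rw [integral_sub (integrable_const _) (integrable_exp_neg_mul_abs_rpow (by norm_num) hs),
      integral_sub (integrable_const _) (integrable_exp_neg_mul_abs_rpow zero_le_one hs), h]
    simp

theorem stable_absolute_moments (α : ℝ) (hα : α ∈ Set.Ioo (1:ℝ) 2)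
    (μ : Measure ℝ) [IsProbabilityMeasure μ]
    (hchar : ∀ lam : ℝ,
      ∫ x, Complex.exp (Complex.I * (lam : ℂ) * (x : ℂ)) ∂μ =
        (Real.exp (-(|lam| ^ α)) : ℝ)) :
    ∀ γ : ℝ, -1 < γ → γ < α →
      ∫ x, |x| ^ γ ∂μ =
        2 ^ γ * Real.Gamma ((1 + γ) / 2) * Real.Gamma ((α - γ) / α) /
          (Real.sqrt Real.pi * Real.Gamma ((2 - γ) / 2)) := by
  intro γ hγ1 hγα
  obtain ⟨hα1, hα2⟩ := hα
  have hα0 : 0 < α := by linarith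
  have hchar' : ∀ lam : ℝ, charFun μ lam = (Real.exp (-(|lam| ^ α)) : ℝ) := by
    intro lam
    rw [charFun_apply_real, ← hchar lam]
    refine integral_congr_ae (ae_of_all _ fun x ↦ ?_)
    simp only
    congr 1; ring
  rcases eq_or_ne γ 0 with rfl | hγ
  · have : Real.sqrt Real.pi ≠ 0 := by positivity
    rw [add_zero, Real.Gamma_one_half_eq]
    simp [hα0.ne', this]
  have hatom : gaussianReal 0 1 {(0 : ℝ)} = 0 := by
    have := nullSingletonClass_gaussianReal (μ := 0) (v := 1) one_ne_zero
    exact measure_singleton 0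
  have hstable := lintegral_Ioi_lintegral_mellinKernel (μ := μ) (γ := γ) (b := 2) (c := 1 / 2) hγ
    one_le_two (by linarith) (by norm_num) (measure_singleton_zero_of_charFun_stable hα0 hchar')
  have hgauss := lintegral_Ioi_lintegral_mellinKernel (μ := gaussianReal 0 1) (γ := γ) (b := α)
    (c := 1) hγ hα1.le hγα one_pos hatom
  have hkernel : ∫⁻ s in Ioi (0 : ℝ), ENNReal.ofReal (s ^ (-γ - 1)) *
        ENNReal.ofReal (∫ x, mellinKernel γ (1 / 2 * |x| ^ (2 : ℝ) * s ^ (2 : ℝ)) ∂μ) =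
      ∫⁻ s in Ioi (0 : ℝ), ENNReal.ofReal (s ^ (-γ - 1)) *
        ENNReal.ofReal (∫ u, mellinKernel γ (1 * |u| ^ α * s ^ α) ∂(gaussianReal 0 1)) :=
    setLIntegral_congr_fun measurableSet_Ioi fun s hs ↦ by
      simp only [integral_mellinKernel_eq_of_charFun_stable hchar' γ hs]
  rw [hstable, hgauss] at hkernel
  have hmoment : ∀ ν : Measure ℝ,
      (∫⁻ x, ENNReal.ofReal (|x| ^ γ) ∂ν).toReal = ∫ x, |x| ^ γ ∂ν := fun ν ↦
    (integral_eq_lintegral_of_nonneg_ae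
      (ae_of_all _ fun x ↦ by simp only [Pi.zero_apply]; positivity)
      (Measurable.aestronglyMeasurable (by fun_prop))).symm
  have hΓ2 : 0 < Real.Gamma (1 - γ / 2) := Real.Gamma_pos_of_pos (by linarith)
  have hΓα : 0 < Real.Gamma (1 - γ / α) :=
    Real.Gamma_pos_of_pos (by rw [sub_pos, div_lt_one hα0]; exact hγα)
  have hreal := congrArg ENNReal.toReal hkernel
  rw [ENNReal.toReal_mul, ENNReal.toReal_mul, hmoment, hmoment,
    ENNReal.toReal_ofReal (by positivity), ENNReal.toReal_ofReal (by positivity),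
    integral_abs_rpow_gaussianReal hγ1, Real.one_rpow, one_div, Real.inv_rpow two_pos.le] at hreal
  have habs : |γ| ≠ 0 := abs_ne_zero.2 hγ
  have hsqrt : Real.sqrt Real.pi ≠ 0 := by positivity
  have hpow : (2 : ℝ) ^ (γ / 2) ≠ 0 := by positivity
  have hsplit : (2 : ℝ) ^ γ = 2 ^ (γ / 2) * 2 ^ (γ / 2) := by
    rw [← Real.rpow_add two_pos]; congr 1; ring
  rw [show (α - γ) / α = 1 - γ / α by field_simp, show (2 - γ) / 2 = 1 - γ / 2 by ring, hsplit,
    eq_div_iff (by positivity)]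
  have hΓ2' := hΓ2.ne'
  generalize Real.Gamma (1 - γ / 2) = A at *
  generalize Real.Gamma (1 - γ / α) = B at *
  generalize (2 : ℝ) ^ (γ / 2) = C at *
  field_simp at hreal ⊢
  linear_combination hreal
end

section
/- Let α ∈ (1,2). Then the function u ↦ (|1+u|^{α−1} − 1)²/|u|^{α+1} is integrable on ℝ; for every z ≠ 0, ∫ℝ (|z+y|^{α−1} − |z|^{α−1})²/|y|^{α+1} dy = |z|^{α−2}·∫ℝ (|1+u|^{α−1} − 1)²/|u|^{α+1} du; and c₅(α)·∫ℝ (|1+u|^{α−1} − 1)²/|u|^{α+1} du = (2(α−1)/α)·m_{2(α−1)}/m_{α−2}, where c₅(α) = α/(2Γ(1−α)cos(απ/2)) and m_β := 2^β Γ((1+β)/2) Γ((α−β)/α)/(√π Γ((2−β)/2)) for −1 < β < α. -/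
open MeasureTheory

/-- absolute moment `E|X₁|^β` of a standard symmetric `α`-stable variable. -/
noncomputable def stableMoment (α β : ℝ) : ℝ :=
  2 ^ β * Real.Gamma ((1 + β) / 2) * Real.Gamma ((α - β) / α) /
    (Real.sqrt Real.pi * Real.Gamma ((2 - β) / 2))

open Set Filter Topology ProbabilityTheory

lemma integral_rpow_mul_one_sub_rpow {u v : ℝ} (hu : 0 < u) (hv : 0 < v) :
    IntegrableOn (fun x : ℝ => x ^ (u - 1) * (1 - x) ^ (v - 1)) (Ioo 0 1) ∧
      ∫ x in Ioo (0 : ℝ) 1, x ^ (u - 1) * (1 - x) ^ (v - 1) = beta u v := by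
  have key : ∀ x ∈ Ioo (0 : ℝ) 1, ((x : ℂ) ^ ((u : ℂ) - 1) * (1 - (x : ℂ)) ^ ((v : ℂ) - 1)) =
      ((x ^ (u - 1) * (1 - x) ^ (v - 1) : ℝ) : ℂ) := by
    intro x hx
    rw [Complex.ofReal_mul, Complex.ofReal_cpow hx.1.le, Complex.ofReal_cpow (by linarith [hx.2])]
    push_cast
    rfl
  have hint : IntegrableOn (fun x : ℝ => ((x ^ (u - 1) * (1 - x) ^ (v - 1) : ℝ) : ℂ))
      (Ioo 0 1) := by
    have h := Complex.betaIntegral_convergent (u := u) (v := v) (by simpa) (by simpa)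
    rw [intervalIntegrable_iff_integrableOn_Ioo_of_le zero_le_one] at h
    exact h.congr_fun key measurableSet_Ioo
  refine ⟨by simpa [IntegrableOn] using hint.re, ?_⟩
  rw [beta_eq_betaIntegralReal u v hu hv, Complex.betaIntegral,
    intervalIntegral.integral_of_le zero_le_one, integral_Ioc_eq_integral_Ioo,
    setIntegral_congr_fun measurableSet_Ioo key, integral_complex_ofReal, Complex.ofReal_re]

lemma image_inv_sub_Ioo (c : ℝ) : (fun x : ℝ => x⁻¹ - c) '' Ioo 0 1 = Ioi (1 - c) := by
  ext y
  simp only [mem_image, mem_Ioo, mem_Ioi]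
  constructor
  · rintro ⟨x, ⟨h0, h1⟩, rfl⟩
    linarith [(one_lt_inv₀ h0).2 h1]
  · intro hy
    have : 1 < y + c := by linarith
    exact ⟨(y + c)⁻¹, ⟨by positivity, inv_lt_one_of_one_lt₀ this⟩, by simp⟩

lemma integral_Ioi_eq_integral_comp_inv_sub (c : ℝ) (f : ℝ → ℝ) :
    (IntegrableOn f (Ioi (1 - c)) ↔
      IntegrableOn (fun x => (x ^ 2)⁻¹ * f (x⁻¹ - c)) (Ioo 0 1)) ∧
    ∫ x in Ioi (1 - c), f x = ∫ x in Ioo (0 : ℝ) 1, (x ^ 2)⁻¹ * f (x⁻¹ - c) := by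
  have hd : ∀ x ∈ Ioo (0 : ℝ) 1,
      HasDerivWithinAt (fun x : ℝ => x⁻¹ - c) (-(x ^ 2)⁻¹) (Ioo 0 1) x := fun x hx =>
    ((hasDerivAt_inv hx.1.ne').sub_const c).hasDerivWithinAt
  have hinj : InjOn (fun x : ℝ => x⁻¹ - c) (Ioo 0 1) := fun x _ y _ h => by simpa using h
  have habs : ∀ x : ℝ, |-(x ^ 2)⁻¹| = (x ^ 2)⁻¹ := fun x => by
    rw [abs_neg, abs_of_nonneg (by positivity)]
  rw [← image_inv_sub_Ioo]
  have h1 := integrableOn_image_iff_integrableOn_abs_deriv_smul measurableSet_Ioo hd hinj f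
  have h2 := integral_image_eq_integral_abs_deriv_smul measurableSet_Ioo hd hinj f
  simp only [habs, smul_eq_mul] at h1 h2
  exact ⟨h1, h2⟩

lemma integral_rpow_mul_one_add_rpow {u v : ℝ} (hu : 0 < u) (hv : 0 < v) :
    IntegrableOn (fun x : ℝ => x ^ (u - 1) * (1 + x) ^ (-(u + v))) (Ioi 0) ∧
      ∫ x in Ioi (0 : ℝ), x ^ (u - 1) * (1 + x) ^ (-(u + v)) = beta u v := by
  have h := integral_Ioi_eq_integral_comp_inv_sub 1
    (fun x : ℝ => x ^ (u - 1) * (1 + x) ^ (-(u + v)))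
  have key : EqOn (fun x : ℝ => (x ^ 2)⁻¹ * ((x⁻¹ - 1) ^ (u - 1) * (1 + (x⁻¹ - 1)) ^ (-(u + v))))
      (fun x => x ^ (v - 1) * (1 - x) ^ (u - 1)) (Ioo 0 1) := by
    intro x ⟨h0, h1⟩
    have h1' : 0 < 1 - x := by linarith
    have e : x⁻¹ - 1 = (1 - x) / x := by field_simp
    have e2 : (x ^ 2)⁻¹ = x ^ (-2 : ℝ) := by
      rw [Real.rpow_neg h0.le]; norm_cast
    simp only []
    rw [e, add_comm 1, ← e, sub_add_cancel, e, Real.div_rpow h1'.le h0.le, Real.inv_rpow h0.le,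
      ← Real.rpow_neg h0.le, neg_neg, e2, div_eq_mul_inv, ← Real.rpow_neg h0.le]
    calc _ = (x ^ (-2 : ℝ) * x ^ (-(u - 1)) * x ^ (u + v)) * (1 - x) ^ (u - 1) := by ring
      _ = _ := by
        rw [← Real.rpow_add h0, ← Real.rpow_add h0]; ring_nf
  rw [sub_self] at h
  obtain ⟨hi, he⟩ := integral_rpow_mul_one_sub_rpow hv hu
  refine ⟨h.1.2 (hi.congr_fun key.symm measurableSet_Ioo), ?_⟩
  rw [h.2, setIntegral_congr_fun measurableSet_Ioo key, he, beta, beta, add_comm, mul_comm]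

lemma hasDerivAt_rpow_mul_one_sub_rpow {x : ℝ} (h0 : 0 < x) (h1 : x < 1) (p c : ℝ) :
    HasDerivAt (fun x : ℝ => x ^ (p + 1) * (1 - x) ^ (c + 1))
      ((p + c + 2) * (x ^ p * (1 - x) ^ (c + 1)) - (c + 1) * (x ^ p * (1 - x) ^ c)) x := by
  have h1' : 0 < 1 - x := by linarith
  have ha := Real.hasDerivAt_rpow_const (x := x) (p := p + 1) (.inl h0.ne')
  have hb := ((hasDerivAt_id x).const_sub 1).rpow_const (p := c + 1) (.inl h1'.ne')
  convert! ha.mul hb using 1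
  simp only [id, add_sub_cancel_right]
  rw [Real.rpow_add_one h0.ne', Real.rpow_add_one h1'.ne']
  ring

lemma integrableOn_sq_one_sub_rpow_mul {a q : ℝ} (h1 : 1 < a) (h2 : a < 2) (hq : -1 < q) :
    IntegrableOn (fun x : ℝ => x ^ q * ((1 - x ^ (a - 1)) ^ 2 * (1 - x) ^ (-a - 1)))
      (Ioo 0 1) := by
  have hb := (integral_rpow_mul_one_sub_rpow (u := q + 1) (v := 2 - a) (by linarith)
    (by linarith)).1
  refine Integrable.mono' hb (Measurable.aestronglyMeasurable (by fun_prop)) ?_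
  refine ae_restrict_of_forall_mem measurableSet_Ioo fun x ⟨h0, hx⟩ => ?_
  have hx' : 0 < 1 - x := by linarith
  have hy : x ≤ x ^ (a - 1) := Real.self_le_rpow_of_le_one h0.le hx.le (by linarith)
  have hy1 : x ^ (a - 1) ≤ 1 := Real.rpow_le_one h0.le hx.le (by linarith)
  have hp := Real.rpow_pos_of_pos h0 q
  have hp' := Real.rpow_pos_of_pos hx' (-a - 1)
  rw [Real.norm_of_nonneg (by positivity), add_sub_cancel_right,
    show 2 - a - 1 = (2 : ℕ) + (-a - 1) by push_cast; ring, Real.rpow_add hx',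
    Real.rpow_natCast]
  gcongr

lemma hasDerivAt_regularized {a x : ℝ} (h1 : 1 < a) (h0 : 0 < x) (hx : x < 1) (p : ℝ) :
    HasDerivAt (fun x : ℝ => 1 / a * (x ^ (p + 1) * (1 - x) ^ (-a)) -
        (p + 1 - a) / (a * (a - 1)) * (x ^ (p + 1) * (1 - x) ^ (1 - a)))
      (x ^ p * (1 - x) ^ (-a - 1) -
        (p + 1 - a) * (p + 2 - a) / (a * (a - 1)) * (x ^ p * (1 - x) ^ (1 - a))) x := by
  have ha : a ≠ 0 := by linarith
  have ha1 : a - 1 ≠ 0 := by linarith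
  have d1 := hasDerivAt_rpow_mul_one_sub_rpow h0 hx p (-a - 1)
  have d2 := hasDerivAt_rpow_mul_one_sub_rpow h0 hx p (-a)
  rw [sub_add_cancel] at d1
  rw [neg_add_eq_sub] at d2
  convert! (d1.const_mul (1 / a)).sub (d2.const_mul ((p + 1 - a) / (a * (a - 1)))) using 1
  field_simp
  ring

lemma integral_sq_one_sub_rpow_mul {a : ℝ} (h1 : 1 < a) (h2 : a < 2) :
    ∫ x in Ioo (0 : ℝ) 1,
      (1 + x ^ (1 - a)) * ((1 - x ^ (a - 1)) ^ 2 * (1 - x) ^ (-a - 1)) =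
    1 / a + beta (2 * a - 1) (2 - a) +
      (2 - 2 * a) * (3 - 2 * a) / (a * (a - 1)) * beta (2 - a) (2 - a) := by
  have ha : a ≠ 0 := by linarith
  have ha1 : a - 1 ≠ 0 := by linarith
  have h2a : 2 - a ≠ 0 := by linarith
  set h : ℝ → ℝ := fun x => (1 + x ^ (1 - a)) * ((1 - x ^ (a - 1)) ^ 2 * (1 - x) ^ (-a - 1))
    with hh
  have ih : IntegrableOn h (Ioo 0 1) := by
    have e := (integrableOn_sq_one_sub_rpow_mul (q := 0) h1 h2 (by norm_num)).add
      (integrableOn_sq_one_sub_rpow_mul (q := 1 - a) h1 h2 (by linarith))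
    refine e.congr_fun (fun x _ => ?_) measurableSet_Ioo
    simp only [hh, Pi.add_apply, Real.rpow_zero]
    ring
  obtain ⟨i1, b1⟩ := integral_rpow_mul_one_sub_rpow (u := 2 - a) (v := 2 - a)
    (by linarith) (by linarith)
  obtain ⟨i2, b2⟩ := integral_rpow_mul_one_sub_rpow (u := 1) (v := 2 - a)
    one_pos (by linarith)
  obtain ⟨i3, b3⟩ := integral_rpow_mul_one_sub_rpow (u := 2 * a - 1) (v := 2 - a)
    (by linarith) (by linarith)
  rw [show 2 - a - 1 = 1 - a by ring] at i1 i2 i3 b1 b2 b3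
  set k : ℝ → ℝ := fun x =>
    ((2 - 2 * a) * (3 - 2 * a) / (a * (a - 1)) * (x ^ (1 - a) * (1 - x) ^ (1 - a)) +
      (2 - a) / a * (x ^ ((1 : ℝ) - 1) * (1 - x) ^ (1 - a))) +
      x ^ (2 * a - 1 - 1) * (1 - x) ^ (1 - a) with hk
  have i12 := (i1.const_mul ((2 - 2 * a) * (3 - 2 * a) / (a * (a - 1)))).add
    (i2.const_mul ((2 - a) / a))
  have ik : IntegrableOn k (Ioo 0 1) := i12.add i3
  have hbk : ∫ x in Ioo (0 : ℝ) 1, k x = 1 / a + beta (2 * a - 1) (2 - a) +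
      (2 - 2 * a) * (3 - 2 * a) / (a * (a - 1)) * beta (2 - a) (2 - a) := by
    have e2 : beta 1 (2 - a) = 1 / (2 - a) := by
      have := (Real.Gamma_pos_of_pos (show 0 < 2 - a by linarith)).ne'
      rw [beta, add_comm 1, Real.Gamma_add_one h2a, Real.Gamma_one]
      field_simp
    rw [hk]
    erw [integral_add i12 i3, integral_add (i1.const_mul _) (i2.const_mul _)]
    rw [integral_const_mul, integral_const_mul, b1, b2, b3, e2]
    field_simp
    ring
  set Q : ℝ → ℝ → ℝ := fun p x => 1 / a * (x ^ (p + 1) * (1 - x) ^ (-a)) -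
        (p + 1 - a) / (a * (a - 1)) * (x ^ (p + 1) * (1 - x) ^ (1 - a)) with hQ
  set F : ℝ → ℝ := fun x => Q (1 - a) x - Q 0 x - Q (a - 1) x + Q (2 * a - 1 - 1) x with hF
  have hd : ∀ x ∈ Ioo (0 : ℝ) 1, HasDerivAt F (h x - k x) x := by
    intro x ⟨h0, hx⟩
    have d p := hasDerivAt_regularized h1 h0 hx p
    convert! (((d (1 - a)).sub (d 0)).sub (d (a - 1))).add (d (2 * a - 1 - 1)) using 1
    have e1 : x ^ (1 - a) = (x ^ (a - 1))⁻¹ := by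
      rw [← Real.rpow_neg h0.le, neg_sub]
    have e2 : x ^ (2 * a - 1 - 1) = (x ^ (a - 1)) ^ 2 := by
      rw [← Real.rpow_mul_natCast h0.le]; push_cast; ring_nf
    have hy := (Real.rpow_pos_of_pos h0 (a - 1)).ne'
    simp only [hh, hk, e1, e2, Real.rpow_zero, sub_self]
    generalize x ^ (a - 1) = y at *
    field_simp
    ring
  have hbound : ∀ x ∈ Ioo (0 : ℝ) 1, 0 ≤ F x ∧
      F x ≤ 6 / a * (x ^ (2 - a) * (1 - x) ^ (2 - a)) := by
    intro x ⟨h0, hx⟩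
    have hx' : 0 < 1 - x := by linarith
    have hy : x ≤ x ^ (a - 1) := Real.self_le_rpow_of_le_one h0.le hx.le (by linarith)
    have hy1 : x ^ (a - 1) ≤ 1 := Real.rpow_le_one h0.le hx.le (by linarith)
    have hm := Real.rpow_pos_of_pos h0 (2 - a)
    have hw := Real.rpow_pos_of_pos hx' (-a)
    have e1 : x ^ (1 - a + 1) = x ^ (2 - a) := by ring_nf
    have e2 : x ^ (0 + 1 : ℝ) = x ^ (2 - a) * x ^ (a - 1) := by
      rw [← Real.rpow_add h0]; ring_nf
    have e3 : x ^ (a - 1 + 1) = x ^ (2 - a) * (x ^ (a - 1)) ^ 2 := by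
      rw [← Real.rpow_mul_natCast h0.le, ← Real.rpow_add h0]; push_cast; ring_nf
    have e4 : x ^ (2 * a - 1 - 1 + 1) = x ^ (2 - a) * (x ^ (a - 1)) ^ 3 := by
      rw [← Real.rpow_mul_natCast h0.le, ← Real.rpow_add h0]; push_cast; ring_nf
    have e5 : (1 - x) ^ (1 - a) = (1 - x) ^ (-a) * (1 - x) := by
      rw [← Real.rpow_add_one hx'.ne']; ring_nf
    have e6 : (1 - x) ^ (2 - a) = (1 - x) ^ (-a) * (1 - x) ^ 2 := by
      rw [← Real.rpow_natCast, ← Real.rpow_add hx']; push_cast; ring_nf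
    have hFx : F x = 1 / a * (x ^ (2 - a) * (1 - x) ^ (-a)) *
        ((1 - x ^ (a - 1)) ^ 2 * (1 + x ^ (a - 1)) +
          (1 - x) * ((1 - x ^ (a - 1)) * (2 + x ^ (a - 1) + (x ^ (a - 1)) ^ 2))) := by
      simp only [hF, hQ, e1, e2, e3, e4, e5]
      field_simp
      ring
    have hy0 : 0 < x ^ (a - 1) := h0.trans_le hy
    generalize x ^ (a - 1) = y at *
    rw [hFx, e6]
    have hy' : 0 ≤ 1 - y := by linarith
    have hyx : 1 - y ≤ 1 - x := by linarith
    refine ⟨by positivity, ?_⟩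
    calc _ ≤ 1 / a * (x ^ (2 - a) * (1 - x) ^ (-a)) *
          ((1 - x) ^ 2 * (1 + 1) + (1 - x) * ((1 - x) * (2 + 1 + 1 ^ 2))) := by gcongr
      _ = _ := by ring
  have hcont : Continuous fun x : ℝ => 6 / a * (x ^ (2 - a) * (1 - x) ^ (2 - a)) := by
    have : 0 ≤ 2 - a := by linarith
    exact continuous_const.mul ((Real.continuous_rpow_const this).mul
      ((Real.continuous_rpow_const this).comp (continuous_const.sub continuous_id)))
  have ht0 : Tendsto F (𝓝[>] 0) (𝓝 0) := by
    have hg := (hcont.tendsto 0).mono_left (nhdsWithin_le_nhds (s := Ioi 0))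
    rw [Real.zero_rpow h2a, zero_mul, mul_zero] at hg
    have hmem : ∀ᶠ x : ℝ in 𝓝[>] 0, x ∈ Ioo (0 : ℝ) 1 := Ioo_mem_nhdsGT one_pos
    exact tendsto_of_tendsto_of_tendsto_of_le_of_le' tendsto_const_nhds hg
      (hmem.mono fun x hx => (hbound x hx).1) (hmem.mono fun x hx => (hbound x hx).2)
  have ht1 : Tendsto F (𝓝[<] 1) (𝓝 0) := by
    have hg := (hcont.tendsto 1).mono_left (nhdsWithin_le_nhds (s := Iio 1))
    rw [sub_self, Real.zero_rpow h2a, mul_zero, mul_zero] at hg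
    have hmem : ∀ᶠ x : ℝ in 𝓝[<] 1, x ∈ Ioo (0 : ℝ) 1 := Ioo_mem_nhdsLT one_pos
    exact tendsto_of_tendsto_of_tendsto_of_le_of_le' tendsto_const_nhds hg
      (hmem.mono fun x hx => (hbound x hx).1) (hmem.mono fun x hx => (hbound x hx).2)
  have hint : IntervalIntegrable (fun x => h x - k x) volume 0 1 := by
    rw [intervalIntegrable_iff_integrableOn_Ioo_of_le zero_le_one]
    exact ih.sub ik
  have hftc := intervalIntegral.integral_eq_sub_of_hasDerivAt_of_tendsto one_pos hd hint ht0 ht1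
  rw [intervalIntegral.integral_of_le zero_le_one, integral_Ioc_eq_integral_Ioo,
    integral_sub ih ik, hbk] at hftc
  linarith

lemma integral_sq_rpow_sub_one_div_one_add {a : ℝ} (h1 : 1 < a) (h2 : a < 2) :
    IntegrableOn (fun x : ℝ => (x ^ (a - 1) - 1) ^ 2 / (1 + x) ^ (a + 1)) (Ioi 0) ∧
      ∫ x in Ioi (0 : ℝ), (x ^ (a - 1) - 1) ^ 2 / (1 + x) ^ (a + 1) =
        beta (2 * a - 1) (2 - a) - 1 / a := by
  have ha : a ≠ 0 := by linarith
  obtain ⟨i1, b1⟩ := integral_rpow_mul_one_add_rpow (u := 2 * a - 1) (v := 2 - a)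
    (by linarith) (by linarith)
  obtain ⟨i2, b2⟩ := integral_rpow_mul_one_add_rpow (u := a) (v := 1) (by linarith) one_pos
  obtain ⟨i3, b3⟩ := integral_rpow_mul_one_add_rpow (u := 1) (v := a) one_pos (by linarith)
  rw [show 2 * a - 1 + (2 - a) = a + 1 by ring] at i1 b1
  rw [add_comm 1 a] at i3 b3
  have hΓ := (Real.Gamma_pos_of_pos (show 0 < a by linarith)).ne'
  have e2 : beta a 1 = 1 / a := by
    rw [beta, Real.Gamma_add_one ha, Real.Gamma_one]
    field_simp
  have e3 : beta 1 a = 1 / a := by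
    rw [beta, add_comm 1 a, Real.Gamma_add_one ha, Real.Gamma_one]
    field_simp
  have key : EqOn (fun x : ℝ => x ^ (2 * a - 1 - 1) * (1 + x) ^ (-(a + 1)) -
      2 * (x ^ (a - 1) * (1 + x) ^ (-(a + 1))) + x ^ ((1 : ℝ) - 1) * (1 + x) ^ (-(a + 1)))
      (fun x => (x ^ (a - 1) - 1) ^ 2 / (1 + x) ^ (a + 1)) (Ioi 0) := by
    intro x hx
    have h0 : 0 < x := hx
    have e : x ^ (2 * a - 1 - 1) = (x ^ (a - 1)) ^ 2 := by
      rw [← Real.rpow_mul_natCast h0.le]; push_cast; ring_nf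
    simp only [e, sub_self, Real.rpow_zero]
    rw [Real.rpow_neg (by linarith), div_eq_mul_inv]
    ring
  have i12 := i1.sub (i2.const_mul 2)
  refine ⟨(i12.add i3).congr_fun key measurableSet_Ioi, ?_⟩
  rw [← setIntegral_congr_fun measurableSet_Ioi key]
  erw [integral_add i12 i3, integral_sub i1 (i2.const_mul 2)]
  rw [integral_const_mul, b1, b2, b3, e2, e3]
  ring

lemma integral_sq_rpow_sub_one_div_abs_sub_one {a : ℝ} (h1 : 1 < a) (h2 : a < 2) :
    IntegrableOn (fun x : ℝ => (x ^ (a - 1) - 1) ^ 2 / |x - 1| ^ (a + 1)) (Ioi 0) ∧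
      ∫ x in Ioi (0 : ℝ), (x ^ (a - 1) - 1) ^ 2 / |x - 1| ^ (a + 1) =
        1 / a + beta (2 * a - 1) (2 - a) +
          (2 - 2 * a) * (3 - 2 * a) / (a * (a - 1)) * beta (2 - a) (2 - a) := by
  set g : ℝ → ℝ := fun x => (x ^ (a - 1) - 1) ^ 2 / |x - 1| ^ (a + 1) with hg
  have i0 := integrableOn_sq_one_sub_rpow_mul (q := 0) h1 h2 (by norm_num)
  have i1 := integrableOn_sq_one_sub_rpow_mul (q := 1 - a) h1 h2 (by linarith)
  have key0 : EqOn (fun x : ℝ => x ^ (0 : ℝ) * ((1 - x ^ (a - 1)) ^ 2 * (1 - x) ^ (-a - 1))) g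
      (Ioo 0 1) := by
    intro x ⟨h0, hx⟩
    have hx' : 0 < 1 - x := by linarith
    simp only [hg, Real.rpow_zero, one_mul]
    rw [abs_sub_comm, abs_of_pos hx', show -a - 1 = -(a + 1) by ring, Real.rpow_neg hx'.le,
      div_eq_mul_inv, sub_sq_comm]
  have key1 : EqOn (fun x : ℝ => x ^ (1 - a) * ((1 - x ^ (a - 1)) ^ 2 * (1 - x) ^ (-a - 1)))
      (fun x => (x ^ 2)⁻¹ * g (x⁻¹ - 0)) (Ioo 0 1) := by
    intro x ⟨h0, hx⟩
    have hx' : 0 < 1 - x := by linarith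
    have e : x⁻¹ - 1 = (1 - x) / x := by field_simp
    have e1 : x ^ (1 - a) = (x ^ (a - 1))⁻¹ := by
      rw [← Real.rpow_neg h0.le, neg_sub]
    have e2 : x ^ (a + 1) = x ^ (a - 1) * x ^ 2 := by
      rw [← Real.rpow_natCast, ← Real.rpow_add h0]; push_cast; ring_nf
    have hy := Real.rpow_pos_of_pos h0 (a - 1)
    have hw := Real.rpow_pos_of_pos hx' (a + 1)
    simp only [hg, sub_zero]
    rw [e, abs_of_pos (by positivity), Real.div_rpow hx'.le h0.le, Real.inv_rpow h0.le,
      show -a - 1 = -(a + 1) by ring, Real.rpow_neg hx'.le, e1, e2]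
    field_simp
  have hv := integral_Ioi_eq_integral_comp_inv_sub 0 g
  rw [sub_zero] at hv
  have j0 : IntegrableOn g (Ioc 0 1) :=
    (integrableOn_Ioc_iff_integrableOn_Ioo (by finiteness)).2 (i0.congr_fun key0 measurableSet_Ioo)
  have j1 : IntegrableOn g (Ioi 1) := hv.1.2 (i1.congr_fun key1 measurableSet_Ioo)
  rw [← Ioc_union_Ioi_eq_Ioi (zero_le_one' ℝ)]
  refine ⟨j0.union j1, ?_⟩
  rw [setIntegral_union Ioc_disjoint_Ioi_same measurableSet_Ioi j0 j1, hv.2,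
    integral_Ioc_eq_integral_Ioo, ← setIntegral_congr_fun measurableSet_Ioo key0,
    ← setIntegral_congr_fun measurableSet_Ioo key1, ← integral_add i0 i1,
    ← integral_sq_one_sub_rpow_mul h1 h2]
  refine setIntegral_congr_fun measurableSet_Ioo fun x _ => ?_
  simp only [Real.rpow_zero]
  ring

lemma integral_sq_abs_one_add_rpow_sub_one_div {a : ℝ} (h1 : 1 < a) (h2 : a < 2) :
    Integrable (fun u : ℝ => (|1 + u| ^ (a - 1) - 1) ^ 2 / |u| ^ (a + 1)) ∧
      ∫ u : ℝ, (|1 + u| ^ (a - 1) - 1) ^ 2 / |u| ^ (a + 1) =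
        2 * beta (2 * a - 1) (2 - a) +
          (2 - 2 * a) * (3 - 2 * a) / (a * (a - 1)) * beta (2 - a) (2 - a) := by
  set g : ℝ → ℝ := fun x => (|x| ^ (a - 1) - 1) ^ 2 / |x - 1| ^ (a + 1) with hg
  obtain ⟨ip, bp⟩ := integral_sq_rpow_sub_one_div_abs_sub_one h1 h2
  obtain ⟨im, bm⟩ := integral_sq_rpow_sub_one_div_one_add h1 h2
  have keyp : EqOn (fun x : ℝ => (x ^ (a - 1) - 1) ^ 2 / |x - 1| ^ (a + 1)) g (Ioi 0) :=
    fun x hx => by simp only [hg]; rw [abs_of_pos (mem_Ioi.1 hx)]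
  have keym : EqOn (fun x : ℝ => (x ^ (a - 1) - 1) ^ 2 / (1 + x) ^ (a + 1)) (fun x => g (-x))
      (Ioi 0) := fun x hx => by
    have h0 : 0 < x := hx
    simp only [hg]
    rw [abs_neg, abs_of_pos h0, show -x - 1 = -(1 + x) by ring, abs_neg,
      abs_of_pos (by linarith)]
  have jp : IntegrableOn g (Ioi 0) := ip.congr_fun keyp measurableSet_Ioi
  have jm : IntegrableOn g (Iic 0) := by
    have h := im.congr_fun keym measurableSet_Ioi
    rw [← integrableOn_Ici_iff_integrableOn_Ioi] at h
    have := (Measure.measurePreserving_neg (volume : Measure ℝ)).integrableOn_comp_preimage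
      (Homeomorph.neg ℝ).measurableEmbedding (f := g) (s := Iic 0)
    rw [show (Neg.neg ⁻¹' Iic 0 : Set ℝ) = Ici 0 by ext; simp] at this
    exact this.1 h
  have hgi : Integrable g := by
    rw [← integrableOn_univ, ← Iic_union_Ioi (a := (0 : ℝ))]
    exact jm.union jp
  have hshift : (fun u : ℝ => (|1 + u| ^ (a - 1) - 1) ^ 2 / |u| ^ (a + 1)) =
      fun u => g (u + 1) := by
    ext u
    simp only [hg, add_sub_cancel_right, add_comm]
  rw [hshift]
  refine ⟨hgi.comp_add_right 1, ?_⟩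
  rw [integral_add_right_eq_self g 1, ← intervalIntegral.integral_Iic_add_Ioi jm jp,
    ← setIntegral_congr_fun measurableSet_Ioi keyp, bp,
    show (∫ x in Iic (0 : ℝ), g x) = ∫ x in Ioi (0 : ℝ), g (-x) by
      rw [integral_comp_neg_Ioi, neg_zero],
    ← setIntegral_congr_fun measurableSet_Ioi keym, bm]
  ring

lemma integral_sq_abs_add_rpow_sub_div (a : ℝ) {z : ℝ} (hz : z ≠ 0) :
    ∫ y : ℝ, (|z + y| ^ (a - 1) - |z| ^ (a - 1)) ^ 2 / |y| ^ (a + 1) =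
      |z| ^ (a - 2) * ∫ u : ℝ, (|1 + u| ^ (a - 1) - 1) ^ 2 / |u| ^ (a + 1) := by
  have hz0 : 0 < |z| := abs_pos.2 hz
  have h := Measure.integral_comp_mul_left
    (fun y : ℝ => (|z + y| ^ (a - 1) - |z| ^ (a - 1)) ^ 2 / |y| ^ (a + 1)) z
  have e1 : (|z| ^ (a - 1)) ^ 2 = |z| ^ (a + 1) * (|z|⁻¹ * |z| ^ (a - 2)) := by
    rw [← Real.rpow_neg_one, ← Real.rpow_add hz0, ← Real.rpow_add hz0,
      ← Real.rpow_mul_natCast hz0.le]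
    push_cast
    ring_nf
  have hp := Real.rpow_pos_of_pos hz0 (a + 1)
  have key : ∀ u : ℝ, (|z + z * u| ^ (a - 1) - |z| ^ (a - 1)) ^ 2 / |z * u| ^ (a + 1) =
      |z|⁻¹ * |z| ^ (a - 2) * ((|1 + u| ^ (a - 1) - 1) ^ 2 / |u| ^ (a + 1)) := fun u => by
    rw [show z + z * u = z * (1 + u) by ring, abs_mul, abs_mul, Real.mul_rpow (abs_nonneg _)
      (abs_nonneg _), Real.mul_rpow (abs_nonneg _) (abs_nonneg _), ← mul_sub_one, mul_pow, e1,
      mul_assoc, mul_div_mul_left _ _ hp.ne', mul_div_assoc]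
  simp only [key] at h
  rw [integral_const_mul, abs_inv, smul_eq_mul, mul_assoc] at h
  exact (mul_left_cancel₀ (inv_ne_zero hz0.ne') h).symm

lemma sub_div_Gamma_eq_sin_mul_Gamma {a : ℝ} (h1 : 1 < a) (h2 : a < 2) :
    (3 - 2 * a) / Real.Gamma (4 - 2 * a) =
      Real.sin (2 * (a * Real.pi)) * Real.Gamma (2 * a - 2) / Real.pi := by
  rcases eq_or_ne (3 - 2 * a) 0 with h | h
  · have ha : 2 * (a * Real.pi) = Real.pi + 2 * Real.pi := by
      linear_combination (-Real.pi) * h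
    rw [h, ha, Real.sin_add_two_pi, Real.sin_pi]
    simp
  · have hG4 : Real.Gamma (4 - 2 * a) ≠ 0 := (Real.Gamma_pos_of_pos (by linarith)).ne'
    have hG : Real.Gamma (4 - 2 * a) = (3 - 2 * a) * Real.Gamma (3 - 2 * a) := by
      rw [← Real.Gamma_add_one h]; ring_nf
    have hG3 : Real.Gamma (3 - 2 * a) ≠ 0 := fun h0 => hG4 (by rw [hG, h0, mul_zero])
    have hG1 : Real.Gamma (2 * a - 2) ≠ 0 := (Real.Gamma_pos_of_pos (by linarith)).ne'
    have hr := Real.Gamma_mul_Gamma_one_sub (2 * a - 2)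
    rw [show 1 - (2 * a - 2) = 3 - 2 * a by ring,
      show Real.pi * (2 * a - 2) = 2 * (a * Real.pi) - 2 * Real.pi by ring,
      Real.sin_sub_two_pi] at hr
    have hs : Real.sin (2 * (a * Real.pi)) ≠ 0 := fun h0 => by
      rw [h0, div_zero] at hr
      exact mul_ne_zero hG1 hG3 hr
    have hpi := Real.pi_ne_zero
    rw [eq_div_iff hs] at hr
    rw [hG, div_eq_div_iff (mul_ne_zero h hG3) hpi]
    linear_combination (-(3 - 2 * a)) * hr

lemma stableMoment_div_stableMoment {a : ℝ} (h1 : 1 < a) (h2 : a < 2) :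
    (2 * (a - 1) / a) * stableMoment a (2 * (a - 1)) / stableMoment a (a - 2) =
      (a - 1) * 2 ^ a * Real.Gamma (a - 1 / 2) * Real.Gamma (1 - a / 2) /
        (Real.Gamma (2 - a) * Real.Gamma ((a - 1) / 2)) := by
  have ha : a ≠ 0 := by linarith
  have h2a : 2 - a ≠ 0 := by linarith
  have h2a0 : 0 < 2 - a := by linarith
  have hq : 2 / a - 1 = (2 - a) / a := by field_simp
  have hq0 : 0 < 2 / a - 1 := by rw [hq]; positivity
  have hG8 : Real.Gamma (2 / a - 1) ≠ 0 := (Real.Gamma_pos_of_pos hq0).ne'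
  have hG4 : Real.Gamma (2 - a) ≠ 0 := (Real.Gamma_pos_of_pos h2a0).ne'
  have hG6 : Real.Gamma ((a - 1) / 2) ≠ 0 := (Real.Gamma_pos_of_pos (by linarith)).ne'
  have e8 : Real.Gamma (2 / a) = (2 / a - 1) * Real.Gamma (2 / a - 1) := by
    rw [← Real.Gamma_add_one hq0.ne', sub_add_cancel]
  have e5 : Real.Gamma ((2 - (a - 2)) / 2) = (1 - a / 2) * Real.Gamma (1 - a / 2) := by
    rw [← Real.Gamma_add_one (by linarith)]; ring_nf
  have hpi : Real.sqrt Real.pi ≠ 0 := (Real.sqrt_pos.2 Real.pi_pos).ne'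
  have ht : (2 : ℝ) ^ a ≠ 0 := by positivity
  have et : (2 : ℝ) ^ (2 * (a - 1)) = (2 ^ a) ^ 2 / 4 := by
    rw [← Real.rpow_mul_natCast (by norm_num),
      show 2 * (a - 1) = a * (2 : ℕ) - 2 by push_cast; ring,
      Real.rpow_sub (by norm_num)]
    norm_num
  have et' : (2 : ℝ) ^ (a - 2) = 2 ^ a / 4 := by
    rw [Real.rpow_sub (by norm_num)]; norm_num
  unfold stableMoment
  rw [e5, et, et', show (1 + 2 * (a - 1)) / 2 = a - 1 / 2 by ring,
    show (a - 2 * (a - 1)) / a = 2 / a - 1 by field_simp; ring,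
    show (2 - 2 * (a - 1)) / 2 = 2 - a by ring, show (1 + (a - 2)) / 2 = (a - 1) / 2 by ring,
    show (a - (a - 2)) / a = 2 / a by ring, e8, hq]
  rw [hq] at hG8
  have : 1 - a / 2 = (2 - a) / 2 := by ring
  have hG5 : Real.Gamma (1 - a / 2) ≠ 0 := (Real.Gamma_pos_of_pos (by linarith)).ne'
  generalize Real.Gamma (1 - a / 2) = G5 at *
  generalize Real.Gamma ((2 - a) / a) = G8 at *
  rw [this]
  field_simp

lemma stable_gamma_identity {a : ℝ} (h1 : 1 < a) (h2 : a < 2) :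
    (a / (2 * Real.Gamma (1 - a) * Real.cos (a * Real.pi / 2))) *
      (2 * beta (2 * a - 1) (2 - a) +
        (2 - 2 * a) * (3 - 2 * a) / (a * (a - 1)) * beta (2 - a) (2 - a)) =
      (2 * (a - 1) / a) * stableMoment a (2 * (a - 1)) / stableMoment a (a - 2) := by
  rw [stableMoment_div_stableMoment h1 h2]
  have ha : a ≠ 0 := by linarith
  have ha1 : a - 1 ≠ 0 := by linarith
  have ha1' : 1 - a ≠ 0 := by linarith
  have hK := sub_div_Gamma_eq_sin_mul_Gamma h1 h2
  have hpi := Real.pi_ne_zero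
  have hpi' : Real.sqrt Real.pi ≠ 0 := (Real.sqrt_pos.2 Real.pi_pos).ne'
  have hsq : Real.sqrt Real.pi ^ 2 = Real.pi := Real.sq_sqrt Real.pi_pos.le
  have hG1 : Real.Gamma (2 * a - 2) ≠ 0 := (Real.Gamma_pos_of_pos (by linarith)).ne'
  have hG2 : Real.Gamma (a - 1) ≠ 0 := (Real.Gamma_pos_of_pos (by linarith)).ne'
  have hG4 : Real.Gamma (2 - a) ≠ 0 := (Real.Gamma_pos_of_pos (by linarith)).ne'
  have hG6 : Real.Gamma ((a - 1) / 2) ≠ 0 := (Real.Gamma_pos_of_pos (by linarith)).ne'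
  have hG7 : Real.Gamma ((3 - a) / 2) ≠ 0 := (Real.Gamma_pos_of_pos (by linarith)).ne'
  have e0 : Real.Gamma (1 - a) = Real.Gamma (2 - a) / (1 - a) := by
    rw [eq_div_iff ha1', mul_comm, ← Real.Gamma_add_one ha1']; ring_nf
  have e1 : Real.Gamma (2 * a - 1) = (2 * a - 2) * Real.Gamma (2 * a - 2) := by
    rw [← Real.Gamma_add_one (by linarith)]; ring_nf
  have e2 : Real.Gamma (a + 1) = a * ((a - 1) * Real.Gamma (a - 1)) := by
    rw [Real.Gamma_add_one ha, ← Real.Gamma_add_one ha1, sub_add_cancel]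
  have r1 := Real.Gamma_mul_Gamma_one_sub (a - 1)
  have r2 := Real.Gamma_mul_Gamma_one_sub ((a - 1) / 2)
  have d1 := Real.Gamma_mul_Gamma_add_half (a - 1)
  have d2 := Real.Gamma_mul_Gamma_add_half (1 - a / 2)
  have et : (2 : ℝ) ^ (1 - 2 * (a - 1)) = 8 / (2 ^ a) ^ 2 := by
    rw [← Real.rpow_mul_natCast (by norm_num),
      show 1 - 2 * (a - 1) = 3 - a * (2 : ℕ) by push_cast; ring, Real.rpow_sub (by norm_num)]
    norm_num
  have et' : (2 : ℝ) ^ (1 - 2 * (1 - a / 2)) = 2 ^ a / 2 := by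
    rw [show 1 - 2 * (1 - a / 2) = a - 1 by ring, Real.rpow_sub (by norm_num)]; norm_num
  rw [show 1 - (a - 1) = 2 - a by ring,
    show Real.pi * (a - 1) = 2 * (a * Real.pi / 2) - Real.pi by ring,
    Real.sin_sub_pi, Real.sin_two_mul] at r1
  rw [show 1 - (a - 1) / 2 = (3 - a) / 2 by ring,
    show Real.pi * ((a - 1) / 2) = a * Real.pi / 2 - Real.pi / 2 by ring,
    Real.sin_sub_pi_div_two] at r2
  rw [et, show a - 1 + 1 / 2 = a - 1 / 2 by ring, show 2 * (a - 1) = 2 * a - 2 by ring] at d1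
  rw [et', show 1 - a / 2 + 1 / 2 = (3 - a) / 2 by ring, show 2 * (1 - a / 2) = 2 - a by ring] at d2
  rw [show 2 * (a * Real.pi) = 2 * (2 * (a * Real.pi / 2)) by ring, Real.sin_two_mul,
    Real.sin_two_mul, Real.cos_two_mul] at hK
  have hG24 := mul_ne_zero hG2 hG4
  have hG67 := mul_ne_zero hG6 hG7
  have ht : (2 : ℝ) ^ a ≠ 0 := by positivity
  unfold beta
  rw [show 2 * a - 1 + (2 - a) = a + 1 by ring, show 2 - a + (2 - a) = 4 - 2 * a by ring,
    show (2 - 2 * a) * (3 - 2 * a) / (a * (a - 1)) *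
      (Real.Gamma (2 - a) * Real.Gamma (2 - a) / Real.Gamma (4 - 2 * a)) =
      (2 - 2 * a) / (a * (a - 1)) *
      (Real.Gamma (2 - a) * Real.Gamma (2 - a) * ((3 - 2 * a) / Real.Gamma (4 - 2 * a))) by ring,
    hK, e0, e1, e2]
  have hC : Real.cos (a * Real.pi / 2) ≠ 0 := fun h0 => by
    rw [h0] at r2; simp at r2; tauto
  have hS : Real.sin (a * Real.pi / 2) ≠ 0 := fun h0 => by
    rw [h0] at r1; simp at r1; tauto
  generalize Real.cos (a * Real.pi / 2) = C at *
  generalize Real.sin (a * Real.pi / 2) = S at *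
  generalize (2 : ℝ) ^ a = t at *
  generalize Real.Gamma (2 * a - 2) = G1 at *
  generalize Real.Gamma (a - 1) = G2 at *
  generalize Real.Gamma (a - 1 / 2) = G3 at *
  generalize Real.Gamma (2 - a) = G4 at *
  generalize Real.Gamma (1 - a / 2) = G5 at *
  generalize Real.Gamma ((a - 1) / 2) = G6 at *
  generalize Real.Gamma ((3 - a) / 2) = G7 at *
  generalize Real.sqrt Real.pi = q at *
  generalize Real.pi = p at *
  subst hsq
  have f3 : G3 = G1 * (8 / t ^ 2) * q / G2 := by rw [← d1]; field_simp
  have f5 : G5 = G4 * (t / 2) * q / G7 := by rw [← d2]; field_simp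
  have f4 : G4 = q ^ 2 / -(2 * S * C) / G2 := by rw [← r1]; field_simp
  have f7 : G7 = q ^ 2 / -C / G6 := by rw [← r2]; field_simp
  have hq : q ≠ 0 := by assumption
  rw [f3, f5, f7, f4]
  clear * - hC hS ht hG1 hG2 hG6 hq ha ha1 ha1'
  field_simp
  ring

theorem stable_constant_c2 (α : ℝ) (hα : α ∈ Set.Ioo (1:ℝ) 2) :
    Integrable (fun u : ℝ => (|1 + u| ^ (α - 1) - 1) ^ 2 / |u| ^ (α + 1)) ∧
      (∀ z : ℝ, z ≠ 0 →
        ∫ y : ℝ, (|z + y| ^ (α - 1) - |z| ^ (α - 1)) ^ 2 / |y| ^ (α + 1) =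
          |z| ^ (α - 2) *
            ∫ u : ℝ, (|1 + u| ^ (α - 1) - 1) ^ 2 / |u| ^ (α + 1)) ∧
      (α / (2 * Real.Gamma (1 - α) * Real.cos (α * Real.pi / 2))) *
          ∫ u : ℝ, (|1 + u| ^ (α - 1) - 1) ^ 2 / |u| ^ (α + 1) =
        (2 * (α - 1) / α) * stableMoment α (2 * (α - 1)) / stableMoment α (α - 2) := by
  obtain ⟨hi, he⟩ := integral_sq_abs_one_add_rpow_sub_one_div hα.1 hα.2
  refine ⟨hi, fun z hz => integral_sq_abs_add_rpow_sub_div α hz, ?_⟩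
  rw [he]
  exact stable_gamma_identity hα.1 hα.2
end
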